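/- Let n ≥ 1 be an integer. No Lipschitz map F : ℍ → ℝⁿ from the hyperbolic plane to Euclidean n-space is strongly proper; that is, for every Lipschitz F : ℍ → ℝⁿ there exist sequences (x_l) and (y_l) in ℍ with d(x_l, y_l) → ∞ but liminf_{l→∞} ‖F(x_l) − F(y_l)‖ = 0. In particular, no isometric immersion of the hyperbolic plane into any Euclidean space (which is necessarily 1-Lipschitz for the intrinsic distance) can be strongly proper. -/

import Mathlib

open Filter

/-- Pigeonhole in a cube: more than `(2 * m + 1) ^ n` points whose coordinates are at most
`m * δ` in absolute value cannot be pairwise `√n * δ`-separated. -/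
lemma exists_ne_norm_sub_le_of_card_lt {n N m : ℕ} {δ : ℝ} (hδ : 0 < δ)
    (v : Fin N → EuclideanSpace ℝ (Fin n)) (hv : ∀ k, ‖v k‖ ≤ m * δ)
    (hN : (2 * m + 1) ^ n < N) :
    ∃ j k, j ≠ k ∧ ‖v j - v k‖ ≤ √n * δ := by
  let cell : Fin N → Fin n → ℤ := fun k i => ⌊v k i / δ⌋
  have hmaps : ∀ k ∈ (Finset.univ : Finset (Fin N)),
      cell k ∈ Fintype.piFinset (fun _ : Fin n => Finset.Icc (-(m : ℤ)) m) := by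
    intro k _
    rw [Fintype.mem_piFinset]
    intro i
    have hi : |v k i / δ| ≤ m := by
      rw [abs_div, abs_of_pos hδ, div_le_iff₀ hδ]
      exact (PiLp.norm_apply_le (v k) i).trans (hv k)
    rw [abs_le] at hi
    rw [Finset.mem_Icc]
    refine ⟨Int.le_floor.2 (by push_cast; exact hi.1), ?_⟩
    have : ((⌊v k i / δ⌋ : ℤ) : ℝ) ≤ (m : ℤ) := (Int.floor_le _).trans (by simpa using hi.2)
    exact_mod_cast this
  have hcard : (Fintype.piFinset (fun _ : Fin n => Finset.Icc (-(m : ℤ)) m)).card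
      < (Finset.univ : Finset (Fin N)).card := by
    have h : ((m : ℤ) + 1 + m).toNat = 2 * m + 1 := by omega
    simpa [Fintype.card_piFinset, h] using hN
  obtain ⟨j, -, k, -, hjk, hcell⟩ := Finset.exists_ne_map_eq_of_card_lt_of_maps_to hcard hmaps
  refine ⟨j, k, hjk, ?_⟩
  have hcoord : ∀ i, ‖(v j - v k) i‖ ^ 2 ≤ δ ^ 2 := by
    intro i
    have h := Int.abs_sub_lt_one_of_floor_eq_floor (congrFun hcell i)
    rw [← sub_div, abs_div, abs_of_pos hδ, div_lt_one hδ] at h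
    gcongr
    simpa using h.le
  rw [EuclideanSpace.norm_eq]
  calc √(∑ i, ‖(v j - v k) i‖ ^ 2) ≤ √(n * δ ^ 2) := by
        gcongr
        simpa using Finset.sum_le_sum fun i (_ : i ∈ Finset.univ) => hcoord i
    _ = √n * δ := by rw [Real.sqrt_mul (by positivity), Real.sqrt_sq hδ.le]

/-- The point `t + i` of the horocycle of height one. -/
noncomputable def horocyclePoint (t : ℝ) : UpperHalfPlane := ⟨⟨t, 1⟩, one_pos⟩

lemma dist_horocyclePoint (s t : ℝ) :
    dist (horocyclePoint s) (horocyclePoint t) = 2 * Real.arsinh (|s - t| / 2) := by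
  have h : dist (⟨s, 1⟩ : ℂ) ⟨t, 1⟩ = |s - t| := by
    rw [Complex.dist_of_im_eq (z := ⟨s, 1⟩) (w := ⟨t, 1⟩) rfl, Real.dist_eq]
  rw [UpperHalfPlane.dist_eq]
  simp [horocyclePoint, UpperHalfPlane.im, h]

lemma Real.arsinh_le_log_one_add_two_mul {x : ℝ} (hx : 0 ≤ x) :
    Real.arsinh x ≤ Real.log (1 + 2 * x) := by
  have h : √(1 + x ^ 2) ≤ 1 + x := Real.sqrt_le_iff.2 ⟨by positivity, by nlinarith⟩
  have h1 : 0 < √(1 + x ^ 2) := by positivity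
  exact Real.log_le_log (by positivity) (by linarith)

lemma eventually_pow_linear_lt_two_pow (a n : ℕ) :
    ∀ᶠ p : ℕ in atTop, (2 * (a * (p + 1)) + 1) ^ n < 2 ^ p := by
  have h := (tendsto_add_atTop_iff_nat 1).2
    (tendsto_pow_const_div_const_pow_of_one_lt n (one_lt_two (α := ℝ)))
  have hc : (0 : ℝ) < 1 / (2 * (2 * a + 1) ^ n) := by positivity
  filter_upwards [h.eventually_lt_const hc] with p hp
  rw [div_lt_div_iff₀ (by positivity) (by positivity), pow_succ (2 : ℝ)] at hp
  have h2 : ((2 * a + 1 : ℝ) * (p + 1)) ^ n < 2 ^ p := by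
    rw [mul_pow]
    push_cast at hp
    linarith
  have h3 : ((2 * a + 1) * (p + 1)) ^ n < 2 ^ p := by exact_mod_cast h2
  exact (Nat.pow_le_pow_left (by nlinarith) n).trans_lt h3

/-- Exponentially many separated points on a horocycle lie in a ball of linear radius, whereas
Euclidean space has polynomial growth. -/
lemma exists_le_dist_norm_sub_lt {n : ℕ} {F : UpperHalfPlane → EuclideanSpace ℝ (Fin n)} {L : ℝ}
    (hL : 0 ≤ L) (hF : ∀ x y : UpperHalfPlane, ‖F x - F y‖ ≤ L * dist x y)
    {R ε : ℝ} (hR : 0 ≤ R) (hε : 0 < ε) :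
    ∃ x y : UpperHalfPlane, R ≤ dist x y ∧ ‖F x - F y‖ < ε := by
  set M : ℝ := 2 * Real.sinh (R / 2) with hM
  have hM0 : 0 ≤ M := mul_nonneg zero_le_two (Real.sinh_nonneg_iff.2 (by positivity))
  set δ : ℝ := ε / (√n + 1) with hδ_def
  have hδ : 0 < δ := by positivity
  set C : ℝ := 2 * Real.log (1 + M) with hC
  have hC0 : 0 ≤ C := mul_nonneg zero_le_two (Real.log_nonneg (by linarith))
  obtain ⟨a, ha⟩ := exists_nat_ge (L * (2 + C) / δ)
  rw [div_le_iff₀ hδ] at ha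
  obtain ⟨p, hp⟩ := (eventually_pow_linear_lt_two_pow a n).exists
  let z : ℕ → UpperHalfPlane := fun k => horocyclePoint (k * M)
  have hsep : ∀ j k : ℕ, j ≠ k → R ≤ dist (z j) (z k) := by
    intro j k hjk
    have h1 : (1 : ℝ) ≤ |(j : ℝ) - k| := by
      have : (1 : ℤ) ≤ |(j : ℤ) - k| := Int.one_le_abs (by omega)
      exact_mod_cast this
    have h2 : Real.sinh (R / 2) ≤ |j * M - k * M| / 2 := by
      rw [← sub_mul, abs_mul, abs_of_nonneg hM0]
      nlinarith
    have h3 := Real.arsinh_le_arsinh.2 h2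
    rw [Real.arsinh_sinh] at h3
    rw [dist_horocyclePoint]
    linarith
  have hbound : ∀ k : ℕ, k < 2 ^ p → dist (z k) (z 0) ≤ 2 * p + C := by
    intro k hk
    have hk' : (k : ℝ) ≤ 2 ^ p := by exact_mod_cast hk.le
    have h1 : (1 : ℝ) ≤ 2 ^ p := one_le_pow₀ one_le_two
    have h2 : Real.arsinh (k * M / 2) ≤ p + Real.log (1 + M) :=
      calc Real.arsinh (k * M / 2) ≤ Real.log (1 + 2 * (k * M / 2)) :=
            Real.arsinh_le_log_one_add_two_mul (by positivity)
        _ ≤ Real.log (2 ^ p * (1 + M)) :=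
            Real.log_le_log (by positivity) (by nlinarith)
        _ = p * Real.log 2 + Real.log (1 + M) := by
            rw [Real.log_mul (by positivity) (by positivity), Real.log_pow]
        _ ≤ p + Real.log (1 + M) := by
            have : Real.log 2 ≤ 1 := by linarith [Real.log_two_lt_d9]
            gcongr
            exact mul_le_of_le_one_right (by positivity) this
    rw [dist_horocyclePoint]
    simp only [Nat.cast_zero, zero_mul, sub_zero]
    rw [abs_of_nonneg (by positivity)]
    linarith
  obtain ⟨j, k, hjk, h⟩ := exists_ne_norm_sub_le_of_card_lt hδ
    (fun k : Fin (2 ^ p) => F (z k) - F (z 0)) (m := a * (p + 1)) (fun k => by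
      calc ‖F (z k) - F (z 0)‖ ≤ L * dist (z k) (z 0) := hF _ _
        _ ≤ L * (2 * p + C) := by gcongr; exact hbound k k.2
        _ ≤ L * (2 + C) * (p + 1) := by
            rw [mul_assoc]
            gcongr
            nlinarith [mul_nonneg hC0 (Nat.cast_nonneg (α := ℝ) p)]
        _ ≤ a * δ * (p + 1) := by gcongr
        _ = (a * (p + 1) : ℕ) * δ := by push_cast; ring) hp
  refine ⟨z j, z k, hsep _ _ (fun h => hjk (Fin.ext h)), ?_⟩
  rw [sub_sub_sub_cancel_right] at h
  refine h.trans_lt ?_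
  rw [hδ_def, mul_div_assoc', div_lt_iff₀ (by positivity)]
  linarith

/-- **No Lipschitz map of the hyperbolic plane into a Euclidean space is strongly
proper:** there are sequences `(x_l)`, `(y_l)` in `ℍ` whose mutual hyperbolic distance
tends to infinity, yet `liminf ‖F(x_l) - F(y_l)‖ = 0`. -/
theorem hyperbolic_lipschitz_not_stronglyProper
    (n : ℕ) (hn : 1 ≤ n) (F : UpperHalfPlane → EuclideanSpace ℝ (Fin n))
    (hF : ∃ L : ℝ, 0 ≤ L ∧ ∀ x y : UpperHalfPlane, ‖F x - F y‖ ≤ L * dist x y) :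
    ∃ x y : ℕ → UpperHalfPlane,
      Tendsto (fun l => dist (x l) (y l)) atTop atTop ∧
      Filter.liminf (fun l => ‖F (x l) - F (y l)‖) atTop = 0 := by
  obtain ⟨L, hL, hF⟩ := hF
  choose x y hdist hnorm using fun l : ℕ =>
    exists_le_dist_norm_sub_lt hL hF (Nat.cast_nonneg (α := ℝ) l) (Nat.one_div_pos_of_nat (n := l))
  exact ⟨x, y, tendsto_atTop_mono hdist tendsto_natCast_atTop_atTop,
    (squeeze_zero (fun _ => norm_nonneg _) (fun l => (hnorm l).le)
      tendsto_one_div_add_atTop_nhds_zero_nat).liminf_eq⟩
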